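/- For a Tychonoff (completely regular Hausdorff) topological space X, the following are equivalent: (1) the locally convex space C_k(X) of continuous real-valued functions on X with the compact-open topology is tame; (2) C_k(X) is a Namioka–Phelps (NP) space; (3) every compact subset of X is scattered. -/

import Mathlib

open Filter Topology

/-- A sequence of real-valued functions is (combinatorially) independent. -/
def IndepSeq {X : Type*} (f : ℕ → X → ℝ) : Prop :=
  ∃ a b : ℝ, a < b ∧ ∀ P M : Finset ℕ, Disjoint P M →
    ∃ x : X, (∀ n ∈ P, f n x < a) ∧ (∀ n ∈ M, b < f n x)

/-- A family of real-valued functions is tame if it contains no independent sequence. -/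
def IsTameFamily {X : Type*} (F : Set (X → ℝ)) : Prop :=
  ¬ ∃ f : ℕ → X → ℝ, (∀ n, f n ∈ F) ∧ IndepSeq f

/-- A family of real-valued functions on a topological space is fragmented. -/
def IsFragmentedFamily {K : Type*} [TopologicalSpace K] (F : Set (K → ℝ)) : Prop :=
  ∀ A : Set K, A.Nonempty → ∀ ε : ℝ, 0 < ε → ∃ O : Set K, IsOpen O ∧
    (O ∩ A).Nonempty ∧ ∀ f ∈ F, ∀ x ∈ O ∩ A, ∀ y ∈ O ∩ A, |f x - f y| < ε

variable {E : Type*} [AddCommGroup E] [Module ℝ E] [TopologicalSpace E]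

/-- A set of continuous functionals (with the weak-star topology) is equicontinuous. -/
def IsEquicontinuousSet (K : Set (WeakDual ℝ E)) : Prop :=
  ∀ ε : ℝ, 0 < ε → ∃ U ∈ nhds (0 : E), ∀ φ ∈ K, ∀ x ∈ U, |φ x| ≤ ε

/-- The family of functions on `K ⊆ E*` obtained by evaluating the elements of `B ⊆ E`. -/
def evalFamily (B : Set E) (K : Set (WeakDual ℝ E)) : Set (K → ℝ) :=
  {g | ∃ b ∈ B, g = fun φ : K => (φ : WeakDual ℝ E) b}

/-- `E` is a tame locally convex space. -/
def TameSpace (E : Type*) [AddCommGroup E] [Module ℝ E] [TopologicalSpace E] : Prop :=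
  ∀ B : Set E, Bornology.IsVonNBounded ℝ B →
    ∀ K : Set (WeakDual ℝ E), IsEquicontinuousSet K → IsCompact K →
      IsTameFamily (evalFamily B K)

/-- `E` is a Namioka–Phelps space: every bounded subset is Asplund, i.e. fragmented
over every equicontinuous weak-star compact subset of the dual. -/
def NPSpace (E : Type*) [AddCommGroup E] [Module ℝ E] [TopologicalSpace E] : Prop :=
  ∀ B : Set E, Bornology.IsVonNBounded ℝ B →
    ∀ K : Set (WeakDual ℝ E), IsEquicontinuousSet K → IsCompact K →
      IsFragmentedFamily (evalFamily B K)

/-- A topological space is scattered if every nonempty subset has an isolated point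
(in the subspace topology). -/
def IsScatteredSpace (X : Type*) [TopologicalSpace X] : Prop :=
  ∀ T : Set X, T.Nonempty → ∃ x ∈ T, ∃ U : Set X, IsOpen U ∧ U ∩ T = {x}

/-- A fragmented family of continuous functions on a compact space is tame. -/
theorem IsFragmentedFamily.isTameFamily {K : Type*} [TopologicalSpace K] [CompactSpace K]
    {F : Set (K → ℝ)} (hc : ∀ f ∈ F, Continuous f) (hF : IsFragmentedFamily F) :
    IsTameFamily F := by
  rintro ⟨f, hfF, a, b, hab, hind⟩
  have hf n : Continuous (f n) := hc _ (hfF n)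
  let Z : Set K := {x | ∀ n, f n x ≤ a ∨ b ≤ f n x}
  have hZ : IsClosed Z := by
    have : Z = ⋂ n, ({x | f n x ≤ a} ∪ {x | b ≤ f n x}) := by ext; simp [Z]
    rw [this]
    exact isClosed_iInter fun n =>
      (isClosed_le (hf n) continuous_const).union (isClosed_le continuous_const (hf n))
  have : CompactSpace Z := isCompact_iff_compactSpace.mp hZ.isCompact
  let π : Z → ULift (ℕ → Bool) := fun z => ⟨fun n => decide (b ≤ f n z)⟩
  have hπ : Continuous π := by
    refine continuous_uliftUp.comp (continuous_pi fun n => ?_)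
    refine (continuous_bool_rng true).mpr ⟨?_, ?_⟩
    · have : (fun z : Z => decide (b ≤ f n z)) ⁻¹' {true} = {z : Z | b ≤ f n z} := by ext; simp
      rw [this]
      exact isClosed_le continuous_const ((hf n).comp continuous_subtype_val)
    · have : (fun z : Z => decide (b ≤ f n z)) ⁻¹' {true} = {z : Z | f n z ≤ a}ᶜ := by
        ext z
        have := z.2 n
        simp only [Set.mem_preimage, Set.mem_singleton_iff, decide_eq_true_eq, Set.mem_compl_iff,
          Set.mem_ofPred_eq]
        grind
      rw [this]
      exact (isClosed_le ((hf n).comp continuous_subtype_val) continuous_const).isOpen_compl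
  have hsurj : Function.Surjective π := by
    rintro ⟨σ⟩
    let C : ℕ → Set K := fun N => {x | ∀ n < N, if σ n then b ≤ f n x else f n x ≤ a}
    have hC N : IsClosed (C N) := by
      have : C N = ⋂ n, ⋂ (_ : n < N), {x | if σ n then b ≤ f n x else f n x ≤ a} := by
        ext; simp [C]
      rw [this]
      refine isClosed_iInter fun n => isClosed_iInter fun _ => ?_
      cases σ n
      · simpa using isClosed_le (hf n) continuous_const
      · simpa using isClosed_le continuous_const (hf n)
    obtain ⟨x, hx⟩ := IsCompact.nonempty_iInter_of_sequence_nonempty_isCompact_isClosed C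
      (fun N x hx n hn => hx n (by omega))
      (fun N => by
        obtain ⟨x, hx⟩ := hind {n ∈ Finset.range N | σ n = false} {n ∈ Finset.range N | σ n = true}
          (Finset.disjoint_left.mpr (by simp +contextual))
        refine ⟨x, fun n hn => ?_⟩
        have h1 := hx.1 n
        have h2 := hx.2 n
        cases h : σ n <;> simp_all [le_of_lt])
      (hC 0).isCompact hC
    have hx n : if σ n then b ≤ f n x else f n x ≤ a := Set.mem_iInter.mp hx (n + 1) n (by omega)
    refine ⟨⟨x, fun n => ?_⟩, ?_⟩
    · have := hx n
      split_ifs at this <;> tauto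
    · refine congrArg ULift.up (funext fun n => ?_)
      have := hx n
      cases h : σ n <;> simp_all; linarith
  obtain ⟨E, hE, hEs, hmin⟩ := exists_compact_surjective_zorn_subset hπ hsurj
  have hEne : E.Nonempty := by
    rw [← Set.image_nonempty (f := π), hEs]
    exact Set.univ_nonempty
  obtain ⟨O, hO, ⟨_, hyO, y, hyE, rfl⟩, hsmall⟩ :=
    hF (Subtype.val '' E) (hEne.image _) (b - a) (by linarith)
  let E₀ : Set E := {e | (e : Z).1 ∉ O}
  have hE₀ : IsClosed E₀ := hO.isClosed_compl.preimage (f := fun e : E => (e : Z).1) (by fun_prop)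
  have hE₀' : E₀ ≠ Set.univ := fun h =>
    (h ▸ Set.mem_univ (⟨y, hyE⟩ : E) : (⟨y, hyE⟩ : E) ∈ E₀) hyO
  have himg : IsClosed (E.domRestrict π '' E₀) :=
    (hE₀.isCompact.image (hπ.comp continuous_subtype_val)).isClosed
  obtain ⟨τ, hτ⟩ := (Set.ne_univ_iff_exists_notMem _).mp (hmin E₀ hE₀' hE₀)
  have hlim : Tendsto (fun n => (ULift.up (Function.update τ.down n (!τ.down n)) : ULift (ℕ → Bool)))
      atTop (𝓝 τ) := by
    refine (continuous_uliftUp.tendsto τ.down).comp (tendsto_pi_nhds.mpr fun k => ?_)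
    refine tendsto_const_nhds.congr' ?_
    filter_upwards [eventually_gt_atTop k] with n hn
    rw [Function.update_of_ne hn.ne]
  obtain ⟨n, hn⟩ := (hlim.eventually (himg.isOpen_compl.mem_nhds hτ)).exists
  have key : ∀ ρ ∉ E.domRestrict π '' E₀, ∃ z : Z, z.1 ∈ O ∩ Subtype.val '' E ∧ π z = ρ := by
    intro ρ hρ
    obtain ⟨z, hz, rfl⟩ : ρ ∈ π '' E := hEs ▸ Set.mem_univ ρ
    refine ⟨z, ⟨?_, z, hz, rfl⟩, rfl⟩
    by_contra h
    exact hρ ⟨⟨z, hz⟩, h, rfl⟩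
  obtain ⟨z, hz, hzτ⟩ := key τ hτ
  obtain ⟨w, hw, hwτ⟩ := key _ hn
  have h1 := congrFun (congrArg ULift.down hzτ) n
  have h2 := congrFun (congrArg ULift.down hwτ) n
  change _ = Function.update τ.down n (!τ.down n) n at h2
  rw [Function.update_self, ← h1] at h2
  have h3 := abs_lt.mp (hsmall _ (hfF n) _ hz _ hw)
  have hz' := z.2 n
  have hw' := w.2 n
  simp only [π] at h2
  by_cases hb : b ≤ f n z <;> by_cases hb' : b ≤ f n w <;> simp [hb, hb'] at h2 <;> grind

section ContinuousMap

variable {X : Type*} [TopologicalSpace X]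

theorem ContinuousMap.mem_nhds_zero_iff {s : Set C(X, ℝ)} :
    s ∈ 𝓝 0 ↔ ∃ L : Set X, IsCompact L ∧ ∃ δ : ℝ, 0 < δ ∧
      ∀ f : C(X, ℝ), (∀ x ∈ L, |f x| < δ) → f ∈ s := by
  have h := (Metric.nhds_basis_ball (x := (0 : ℝ))).nhds_continuousMapConst (X := X)
  change s ∈ 𝓝 (ContinuousMap.const X 0) ↔ _
  rw [h.mem_iff]
  simp only [Prod.exists, Set.subset_def, Set.MapsTo, Set.mem_ofPred_eq, mem_ball_zero_iff,
    Real.norm_eq_abs]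
  grind

/-- The elements of an equicontinuous set of functionals on `C_k(X)` are uniformly bounded by a
multiple of the supremum seminorm over some compact set. -/
theorem IsEquicontinuousSet.exists_isCompact_bound {K : Set (WeakDual ℝ C(X, ℝ))}
    (hK : IsEquicontinuousSet K) :
    ∃ L : Set X, IsCompact L ∧ ∃ C : ℝ, 0 < C ∧ ∀ φ ∈ K, ∀ t : ℝ, 0 ≤ t → ∀ f : C(X, ℝ),
      (∀ x ∈ L, |f x| ≤ t) → |φ f| ≤ C * t := by
  obtain ⟨U, hU, hφ⟩ := hK 1 one_pos
  obtain ⟨L, hL, δ, hδ, hLU⟩ := ContinuousMap.mem_nhds_zero_iff.mp hU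
  refine ⟨L, hL, δ⁻¹, inv_pos.mpr hδ, fun φ hφK t ht f hf => ?_⟩
  suffices ∀ s > t, |φ f| ≤ δ⁻¹ * s from
    ge_of_tendsto (x := 𝓝[>] t) ((continuous_const_mul δ⁻¹).continuousWithinAt (s := Set.Ioi t))
      (eventually_mem_nhdsWithin.mono this)
  intro s hs
  have hs0 : 0 < s := ht.trans_lt hs
  have hc : 0 < δ / s := div_pos hδ hs0
  have := hφ φ hφK ((δ / s) • f) (hLU _ fun x hx => by
    have := hf x hx
    rw [ContinuousMap.smul_apply, smul_eq_mul, abs_mul, abs_of_pos hc]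
    calc δ / s * |f x| < δ / s * s := by gcongr; linarith
      _ = δ := by field_simp)
  rw [map_smul, smul_eq_mul, abs_mul, abs_of_pos hc] at this
  rw [← div_eq_inv_mul, le_div_iff₀ hδ]
  rw [div_mul_eq_mul_div, div_le_one hs0] at this
  linarith

/-- The continuous functions of absolute value at most one on `L` that vanish on `L \ U`. -/
def unitBallOn (L U : Set X) : Set C(X, ℝ) :=
  {g | (∀ x ∈ L, |g x| ≤ 1) ∧ ∀ x ∈ L, x ∉ U → g x = 0}

/-- Every nonempty subset of `K` has nonempty relatively weak-star open subsets that are small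
uniformly over `unitBallOn L U`. -/
def FragmentedOver (L : Set X) (K : Set (WeakDual ℝ C(X, ℝ))) (U : Set X) : Prop :=
  ∀ A ⊆ K, A.Nonempty → ∀ ε : ℝ, 0 < ε → ∃ O : Set (WeakDual ℝ C(X, ℝ)), IsOpen O ∧
    (O ∩ A).Nonempty ∧ ∀ φ ∈ O ∩ A, ∀ ψ ∈ O ∩ A, ∀ g ∈ unitBallOn L U, |φ g - ψ g| ≤ ε

variable {L : Set X} {K : Set (WeakDual ℝ C(X, ℝ))} {C : ℝ}

theorem fragmentedOver_empty
    (hK : ∀ φ ∈ K, ∀ t : ℝ, 0 ≤ t → ∀ f : C(X, ℝ), (∀ x ∈ L, |f x| ≤ t) → |φ f| ≤ C * t) :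
    FragmentedOver L K ∅ := by
  intro A hA hne ε hε
  refine ⟨Set.univ, isOpen_univ, by simpa using hne, fun φ hφ ψ hψ g hg => ?_⟩
  have h0 : ∀ x ∈ L, |g x| ≤ 0 := fun x hx => by simp [hg.2 x hx]
  have h1 := hK φ (hA hφ.2) 0 le_rfl g h0
  have h2 := hK ψ (hA hψ.2) 0 le_rfl g h0
  rw [mul_zero, abs_nonpos_iff] at h1 h2
  simpa [h1, h2] using hε.le

/-- A function and a cutoff adapted to it: `f'` is uniformly `2 * δ`-close to `f`, the cutoff `χ`
is supported in `{δ < |f|}`, and `χ = 1` wherever `f'` does not vanish. -/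
theorem ContinuousMap.exists_truncation_cutoff (f : C(X, ℝ)) {δ : ℝ} (hδ : 0 < δ) :
    ∃ f' χ : C(X, ℝ), ∀ x, |f x - f' x| ≤ 2 * δ ∧ |f' x| ≤ |f x| ∧ 0 ≤ χ x ∧ χ x ≤ 1 ∧
      (|f x| < δ → χ x = 0) ∧ (f' x = 0 ∨ χ x = 1) := by
  refine ⟨⟨fun x => f x - max (-(2 * δ)) (min (f x) (2 * δ)), by fun_prop⟩,
    ⟨fun x => max 0 (min 1 (|f x| / δ - 1)), by fun_prop⟩, fun x => ?_⟩
  simp only [ContinuousMap.coe_mk]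
  refine ⟨?_, ?_, le_max_left _ _, max_le zero_le_one (min_le_left _ _), fun h => ?_, ?_⟩
  · grind
  · grind
  · have : |f x| / δ < 1 := (div_lt_one hδ).mpr h
    exact max_eq_left ((min_le_right _ _).trans (by linarith))
  · rcases le_total |f x| (2 * δ) with h | h
    · left; grind
    · right
      have : 2 ≤ |f x| / δ := (le_div_iff₀ hδ).mpr h
      rw [min_eq_left (by linarith), max_eq_right zero_le_one]

theorem fragmentedOver_sUnion (hL : IsCompact L) (hC : 0 < C)
    (hK : ∀ φ ∈ K, ∀ t : ℝ, 0 ≤ t → ∀ f : C(X, ℝ), (∀ x ∈ L, |f x| ≤ t) → |φ f| ≤ C * t)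
    {c : Set (Set X)} (hc : c.Nonempty) (hdir : DirectedOn (· ⊆ ·) c)
    (hopen : ∀ U ∈ c, IsOpen U) (hfrag : ∀ U ∈ c, FragmentedOver L K U) :
    FragmentedOver L K (⋃₀ c) := by
  intro A hA ⟨φ₀, hφ₀⟩ ε hε
  set S : Set ℝ := {r | ∃ φ ∈ A, ∃ f ∈ unitBallOn L (⋃₀ c), φ f = r}
  have hS : BddAbove S := by
    refine ⟨C, ?_⟩
    rintro _ ⟨φ, hφ, f, hf, rfl⟩
    simpa using (le_abs_self _).trans (hK φ (hA hφ) 1 zero_le_one f hf.1)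
  have hSne : S.Nonempty := ⟨_, φ₀, hφ₀, 0, ⟨by simp, by simp⟩, rfl⟩
  have hle : ∀ φ ∈ A, ∀ f ∈ unitBallOn L (⋃₀ c), φ f ≤ sSup S := fun φ hφ f hf =>
    le_csSup hS ⟨φ, hφ, f, hf, rfl⟩
  obtain ⟨η, hη, rfl⟩ : ∃ η : ℝ, 0 < η ∧ ε = 8 * η := ⟨ε / 8, by positivity, by ring⟩
  obtain ⟨_, ⟨φ, hφ, f, hf, rfl⟩, hlt⟩ := exists_lt_of_lt_csSup hSne (sub_lt_self (sSup S) hη)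
  obtain ⟨δ, hδ, hδη⟩ : ∃ δ : ℝ, 0 < δ ∧ C * (2 * δ) = η :=
    ⟨η / (2 * C), by positivity, by field_simp⟩
  obtain ⟨f', χ, h⟩ := f.exists_truncation_cutoff hδ
  have hcpt : IsCompact (L ∩ {x | δ ≤ |f x|}) :=
    hL.inter_right (isClosed_le continuous_const (by fun_prop))
  obtain ⟨V, hV, hSV⟩ : ∃ V ∈ c, L ∩ {x | δ ≤ |f x|} ⊆ V := by
    have : Nonempty c := hc.to_subtype
    obtain ⟨V, hV⟩ := hcpt.elim_directed_cover (fun U : c => (U : Set X)) (fun U => hopen U U.2)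
      (fun x hx => by
        by_contra hxU
        rw [← Set.sUnion_eq_iUnion] at hxU
        have := hf.2 x hx.1 hxU
        have h2 : δ ≤ |f x| := hx.2
        rw [this, abs_zero] at h2
        linarith)
      (directedOn_iff_directed.mp hdir)
    exact ⟨V, V.2, hV⟩
  have hφf' : sSup S - 2 * η < φ f' := by
    have := hK φ (hA hφ) (2 * δ) (by positivity) (f - f') (fun x _ => (h x).1)
    rw [map_sub, hδη] at this
    linarith [(abs_le.mp this).2]
  set O₁ : Set (WeakDual ℝ C(X, ℝ)) := {ψ | sSup S - 2 * η < ψ f'}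
  have hO₁ : IsOpen O₁ := isOpen_lt continuous_const (WeakDual.eval_continuous f')
  obtain ⟨O₂, hO₂, hne, hsmall⟩ := hfrag V hV (O₁ ∩ A) (Set.inter_subset_right.trans hA)
    ⟨φ, hφf', hφ⟩ η hη
  refine ⟨O₂ ∩ O₁, hO₂.inter hO₁, by rwa [Set.inter_assoc], fun φ₁ h₁ φ₂ h₂ g hg => ?_⟩
  rw [Set.inter_assoc] at h₁ h₂
  have hgχ : g * χ ∈ unitBallOn L V := by
    refine ⟨fun x hx => ?_, fun x hx hxV => ?_⟩
    · rw [ContinuousMap.mul_apply, abs_mul, abs_of_nonneg (h x).2.2.1]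
      exact mul_le_one₀ (hg.1 x hx) (h x).2.2.1 (h x).2.2.2.1
    · rw [ContinuousMap.mul_apply, (h x).2.2.2.2.1, mul_zero]
      by_contra hx'
      exact hxV (hSV ⟨hx, not_lt.mp hx'⟩)
  have hmem : ∀ s : ℝ, |s| = 1 → f' + s • (g - g * χ) ∈ unitBallOn L (⋃₀ c) := by
    intro s hs
    refine ⟨fun x hx => ?_, fun x hx hxU => ?_⟩
    · obtain ⟨-, h2, h3, h4, -, h6⟩ := h x
      simp only [ContinuousMap.add_apply, ContinuousMap.smul_apply, ContinuousMap.sub_apply,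
        ContinuousMap.mul_apply, smul_eq_mul]
      rcases h6 with h6 | h6
      · rw [h6, zero_add, abs_mul, hs, one_mul, show g x - g x * χ x = g x * (1 - χ x) by ring,
          abs_mul, abs_of_nonneg (by linarith : 0 ≤ 1 - χ x)]
        exact mul_le_one₀ (hg.1 x hx) (by linarith) (by linarith)
      · simpa [h6] using h2.trans (hf.1 x hx)
    · have h2 := (h x).2.1
      rw [hf.2 x hx hxU, abs_zero, abs_nonpos_iff] at h2
      simp [h2, hg.2 x hx hxU]
  have htail : ∀ ψ ∈ O₁ ∩ A, |ψ (g - g * χ)| ≤ 2 * η := by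
    intro ψ hψ
    have h1 := hle ψ hψ.2 _ (hmem 1 (by simp))
    have h2 := hle ψ hψ.2 _ (hmem (-1) (by simp))
    rw [map_add, map_smul, smul_eq_mul] at h1 h2
    have h3 : sSup S - 2 * η < ψ f' := hψ.1
    exact abs_le.mpr ⟨by linarith, by linarith⟩
  have e1 := abs_le.mp (htail φ₁ h₁.2)
  have e2 := abs_le.mp (htail φ₂ h₂.2)
  have e3 := abs_le.mp (hsmall φ₁ h₁ φ₂ h₂ _ hgχ)
  rw [map_sub] at e1 e2
  exact abs_le.mpr ⟨by linarith, by linarith⟩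

variable [CompletelyRegularSpace X] [T2Space X]

theorem FragmentedOver.union_of_isolated (hL : IsCompact L) {U W : Set X} (hU : IsOpen U)
    (hW : IsOpen W) {x : X} (hWx : W ∩ (L \ U) = {x}) (hfrag : FragmentedOver L K U) :
    FragmentedOver L K (U ∪ W) := by
  intro A hA ⟨φ₀, hφ₀⟩ ε hε
  have hx : x ∈ W ∩ (L \ U) := hWx ▸ Set.mem_singleton x
  obtain ⟨h₀, hc, hx0, h1⟩ := CompletelyRegularSpace.completely_regular x (L ∩ (U ∪ W)ᶜ)
    (hL.isClosed.inter (hU.union hW).isClosed_compl) (fun h => h.2 (Or.inr hx.1))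
  let h : C(X, ℝ) := ⟨fun y => 1 - h₀ y, by fun_prop⟩
  obtain ⟨η, hη, rfl⟩ : ∃ η : ℝ, 0 < η ∧ ε = 4 * η := ⟨ε / 4, by positivity, by ring⟩
  set O₁ : Set (WeakDual ℝ C(X, ℝ)) := {ψ | |ψ h - φ₀ h| < η}
  have hO₁ : IsOpen O₁ :=
    isOpen_lt (((WeakDual.eval_continuous h).sub continuous_const).abs) continuous_const
  obtain ⟨O₂, hO₂, hne, hsmall⟩ := hfrag (O₁ ∩ A) (Set.inter_subset_right.trans hA)
    ⟨φ₀, by simpa [O₁] using hη, hφ₀⟩ η hη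
  refine ⟨O₂ ∩ O₁, hO₂.inter hO₁, by rwa [Set.inter_assoc], fun φ₁ h₁ φ₂ h₂ g hg => ?_⟩
  rw [Set.inter_assoc] at h₁ h₂
  have hh : ∀ y, |h y| ≤ 1 := fun y => by
    have := (h₀ y).2
    exact abs_le.mpr ⟨by simp only [h, ContinuousMap.coe_mk]; linarith [this.2],
      by simp only [h, ContinuousMap.coe_mk]; linarith [this.1]⟩
  have hhx : h x = 1 := by simp [h, hx0]
  have hgx := hg.1 x hx.2.1
  have hmem : (1 / 2 : ℝ) • (g - g x • h) ∈ unitBallOn L U := by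
    refine ⟨fun y hy => ?_, fun y hy hyU => ?_⟩
    · have e1 : |g x * h y| ≤ 1 := by
        rw [abs_mul]
        exact mul_le_one₀ hgx (abs_nonneg _) (hh y)
      have e2 := abs_le.mp (hg.1 y hy)
      rw [abs_le] at e1
      simp only [ContinuousMap.smul_apply, ContinuousMap.sub_apply, smul_eq_mul]
      exact abs_le.mpr ⟨by linarith, by linarith⟩
    · by_cases hyW : y ∈ W
      · obtain rfl : y = x := by
          have : y ∈ W ∩ (L \ U) := ⟨hyW, hy, hyU⟩
          rwa [hWx] at this
        simp [hhx]
      · have hyn : y ∉ U ∪ W := by simp [hyU, hyW]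
        have : h y = 0 := by simp [h, h1 ⟨hy, hyn⟩]
        simp [this, hg.2 y hy hyn]
  have e1 := abs_le.mp (hsmall φ₁ h₁ φ₂ h₂ _ hmem)
  rw [map_smul, map_smul, map_sub, map_sub, map_smul, map_smul] at e1
  simp only [smul_eq_mul] at e1
  have e2 : |φ₁ h - φ₀ h| < η := h₁.2.1
  have e3 : |φ₂ h - φ₀ h| < η := h₂.2.1
  have e4 : |g x * (φ₁ h - φ₂ h)| ≤ 2 * η := by
    rw [abs_mul]
    have : |φ₁ h - φ₂ h| ≤ 2 * η := by
      rw [abs_lt] at e2 e3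
      exact abs_le.mpr ⟨by linarith, by linarith⟩
    calc |g x| * |φ₁ h - φ₂ h| ≤ 1 * (2 * η) := by gcongr
      _ = 2 * η := one_mul _
  rw [abs_le] at e4
  exact abs_le.mpr ⟨by linarith, by linarith⟩

theorem fragmentedOver_univ (hL : IsCompact L) (hscat : IsScatteredSpace L) (hC : 0 < C)
    (hK : ∀ φ ∈ K, ∀ t : ℝ, 0 ≤ t → ∀ f : C(X, ℝ), (∀ x ∈ L, |f x| ≤ t) → |φ f| ≤ C * t) :
    FragmentedOver L K Set.univ := by
  obtain ⟨U, -, hmax⟩ := zorn_subset_nonempty {U | IsOpen U ∧ FragmentedOver L K U}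
    (fun c hc hchain hne => ⟨⋃₀ c, ⟨isOpen_sUnion fun U hU => (hc hU).1,
      fragmentedOver_sUnion hL hC hK hne hchain.directedOn (fun U hU => (hc hU).1)
        fun U hU => (hc hU).2⟩, fun _ => Set.subset_sUnion_of_mem⟩)
    ∅ ⟨isOpen_empty, fragmentedOver_empty hK⟩
  have hLU : L ⊆ U := by
    by_contra hLU
    obtain ⟨y, hyL, hyU⟩ := Set.not_subset.mp hLU
    obtain ⟨x, hx, W', hW', hWx⟩ := hscat {x : L | x.1 ∉ U} ⟨⟨y, hyL⟩, hyU⟩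
    obtain ⟨W, hW, rfl⟩ := isOpen_induced_iff.mp hW'
    have hWx' : W ∩ (L \ U) = {x.1} := by
      ext z
      constructor
      · rintro ⟨hzW, hzL, hzU⟩
        have : (⟨z, hzL⟩ : L) ∈ Subtype.val ⁻¹' W ∩ {x : L | x.1 ∉ U} := ⟨hzW, hzU⟩
        rw [hWx] at this
        exact congrArg Subtype.val this
      · rintro rfl
        have : x ∈ Subtype.val ⁻¹' W ∩ {x : L | x.1 ∉ U} := hWx ▸ Set.mem_singleton x
        exact ⟨this.1, x.2, this.2⟩
    have hxW : x.1 ∈ W ∩ (L \ U) := hWx' ▸ Set.mem_singleton x.1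
    exact hx (hmax.2 ⟨hmax.1.1.union hW, hmax.1.2.union_of_isolated hL hmax.1.1 hW hWx'⟩
      Set.subset_union_left (Or.inr hxW.1))
  intro A hA hne ε hε
  obtain ⟨O, hO, hOA, hsmall⟩ := hmax.1.2 A hA hne ε hε
  exact ⟨O, hO, hOA, fun φ hφ ψ hψ g hg =>
    hsmall φ hφ ψ hψ g ⟨hg.1, fun x hx hxU => absurd (hLU hx) hxU⟩⟩

theorem npSpace_of_isScatteredSpace (h : ∀ L : Set X, IsCompact L → IsScatteredSpace L) :
    NPSpace C(X, ℝ) := by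
  intro B hB K hKe _ A hne ε hε
  obtain ⟨L, hL, C, hC, hK⟩ := hKe.exists_isCompact_bound
  have hV : {f : C(X, ℝ) | ∀ x ∈ L, |f x| < 1} ∈ 𝓝 0 :=
    ContinuousMap.mem_nhds_zero_iff.mpr ⟨L, hL, 1, one_pos, fun _ => id⟩
  obtain ⟨r, hr, hBr⟩ := (hB hV).exists_pos
  have hBr := hBr r (le_abs_self r)
  obtain ⟨O, hO, hOA, hsmall⟩ := fragmentedOver_univ hL (h L hL) hC hK (Subtype.val '' A)
    (by rintro _ ⟨φ, -, rfl⟩; exact φ.2) (hne.image _) (ε / (2 * r)) (by positivity)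
  refine ⟨Subtype.val ⁻¹' O, hO.preimage continuous_subtype_val, ?_, ?_⟩
  · obtain ⟨_, hφ, φ, hφA, rfl⟩ := hOA
    exact ⟨φ, hφ, hφA⟩
  · rintro _ ⟨f, hf, rfl⟩ φ hφ ψ hψ
    obtain ⟨g, hg, rfl⟩ := hBr hf
    have := hsmall φ ⟨hφ.1, φ, hφ.2, rfl⟩ ψ ⟨hψ.1, ψ, hψ.2, rfl⟩ g
      ⟨fun x hx => (hg x hx).le, by simp⟩
    simp only [map_smul, smul_eq_mul]
    rw [← mul_sub, abs_mul, abs_of_pos hr]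
    calc r * _ ≤ r * (ε / (2 * r)) := by gcongr
      _ = ε / 2 := by field_simp
      _ < ε := half_lt_self hε

/-- Disjoint finite sets in a Tychonoff space are separated by a continuous function. -/
theorem exists_continuousMap_separating_finset {P Q : Finset X} (hPQ : Disjoint P Q) :
    ∃ f : C(X, ℝ), (∀ x, f x ∈ Set.Icc (0 : ℝ) 1) ∧ (∀ x ∈ P, f x = 0) ∧ ∀ x ∈ Q, f x = 1 := by
  have h (x : X) : ∃ f : C(X, ℝ), (∀ y, f y ∈ Set.Icc (0 : ℝ) 1) ∧
      (x ∈ P → f x = 0) ∧ ∀ y ∈ Q, f y = 1 := by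
    by_cases hx : x ∈ P
    · obtain ⟨f, hf, hx0, hQ⟩ := CompletelyRegularSpace.completely_regular x (Q : Set X)
        Q.finite_toSet.isClosed (Finset.disjoint_left.mp hPQ hx)
      exact ⟨⟨fun y => f y, by fun_prop⟩, fun y => (f y).2, fun _ => by simp [hx0],
        fun y hy => by simp [hQ hy]⟩
    · exact ⟨1, by simp, by simp [hx], by simp⟩
  choose f hf hP hQ using h
  refine ⟨∏ x ∈ P, f x, fun y => ?_, fun x hx => ?_, fun y hy => ?_⟩
  · rw [ContinuousMap.prod_apply]
    exact ⟨Finset.prod_nonneg fun x _ => (hf x y).1,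
      Finset.prod_le_one (fun x _ => (hf x y).1) fun x _ => (hf x y).2⟩
  · rw [ContinuousMap.prod_apply]
    exact Finset.prod_eq_zero hx (hP x hx)
  · rw [ContinuousMap.prod_apply]
    exact Finset.prod_eq_one fun x _ => hQ x y hy

/-- All sign patterns of the functions in `S` are realized on `T`. -/
def IndepOn (T : Set X) (S : Finset C(X, ℝ)) : Prop :=
  ∀ M : Set C(X, ℝ), ∃ x ∈ T, ∀ f ∈ S, (f ∈ M → f x < 1 / 3) ∧ (f ∉ M → 2 / 3 < f x)

open Classical in
theorem IndepOn.exists_insert {T : Set X} (hT : ∀ x ∈ T, ∀ U : Set X, IsOpen U → U ∩ T ≠ {x})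
    {S : Finset C(X, ℝ)} (hS : IndepOn T S) :
    ∃ f : C(X, ℝ), f ∉ S ∧ (∀ x, f x ∈ Set.Icc (0 : ℝ) 1) ∧ IndepOn T (insert f S) := by
  let W (M : Set C(X, ℝ)) : Set X :=
    {x | ∀ f ∈ S, (f ∈ M → f x < 1 / 3) ∧ (f ∉ M → 2 / 3 < f x)}
  have hW M : IsOpen (W M) := by
    have : W M = ⋂ f ∈ S, {x | (f ∈ M → f x < 1 / 3) ∧ (f ∉ M → 2 / 3 < f x)} := by
      ext; simp [W]
    rw [this]
    refine isOpen_biInter_finset fun f _ => ?_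
    by_cases hf : f ∈ M
    · simpa [hf] using isOpen_lt (map_continuous f) continuous_const
    · simpa [hf] using isOpen_lt continuous_const (map_continuous f)
  have hpair M : ∃ x y, x ∈ T ∧ x ∈ W M ∧ y ∈ T ∧ y ∈ W M ∧ x ≠ y := by
    obtain ⟨x, hxT, hx⟩ := hS M
    by_contra! hcon
    refine hT x hxT (W M) (hW M) (Set.eq_singleton_iff_unique_mem.mpr ⟨⟨hx, hxT⟩, ?_⟩)
    exact fun y hy => (hcon x y hxT hx hy.2 hy.1).symm
  choose p q hpT hpW hqT hqW hpq using hpair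
  have hdisj : Disjoint (S.powerset.image fun M : Finset C(X, ℝ) => p M)
      (S.powerset.image fun M : Finset C(X, ℝ) => q M) := by
    rw [Finset.disjoint_left]
    intro x hx hx'
    obtain ⟨M, hM, rfl⟩ := Finset.mem_image.mp hx
    obtain ⟨N, hN, hNM⟩ := Finset.mem_image.mp hx'
    rw [Finset.mem_powerset] at hM hN
    have hMN : M = N := by
      ext f
      by_cases hf : f ∈ S
      · have h1 := hpW M f hf
        have h2 := hqW N f hf
        rw [hNM] at h2
        simp only [Finset.mem_coe] at h1 h2
        grind
      · exact ⟨fun h => absurd (hM h) hf, fun h => absurd (hN h) hf⟩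
    subst hMN
    exact hpq _ hNM.symm
  obtain ⟨f, hf, hP, hQ⟩ := exists_continuousMap_separating_finset hdisj
  have hp {N : Finset C(X, ℝ)} (hN : N ⊆ S) : f (p N) = 0 :=
    hP _ (Finset.mem_image_of_mem _ (Finset.mem_powerset.mpr hN))
  have hq {N : Finset C(X, ℝ)} (hN : N ⊆ S) : f (q N) = 1 :=
    hQ _ (Finset.mem_image_of_mem _ (Finset.mem_powerset.mpr hN))
  refine ⟨f, fun hfS => ?_, hf, fun M => ?_⟩
  · have h := (hpW (∅ : Finset C(X, ℝ)) f hfS).2 (by simp)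
    rw [hp (Finset.empty_subset S)] at h
    norm_num at h
  · by_cases hfM : f ∈ M
    · refine ⟨_, hpT (S.filter (· ∈ M) : Finset _), fun g hg => ?_⟩
      rcases Finset.mem_insert.mp hg with rfl | hgS
      · exact ⟨fun _ => by rw [hp (Finset.filter_subset _ _)]; norm_num, fun h => absurd hfM h⟩
      · simpa [hgS] using hpW (S.filter (· ∈ M) : Finset _) g hgS
    · refine ⟨_, hqT (S.filter (· ∈ M) : Finset _), fun g hg => ?_⟩
      rcases Finset.mem_insert.mp hg with rfl | hgS
      · exact ⟨fun h => absurd h hfM, fun _ => by rw [hq (Finset.filter_subset _ _)]; norm_num⟩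
      · simpa [hgS] using hqW (S.filter (· ∈ M) : Finset _) g hgS

/-- On a nonempty set without isolated points there is an independent sequence of continuous
functions with values in the unit interval. -/
theorem exists_indepSeq_of_no_isolated {T : Set X} (hne : T.Nonempty)
    (hT : ∀ x ∈ T, ∀ U : Set X, IsOpen U → U ∩ T ≠ {x}) :
    ∃ f : ℕ → C(X, ℝ), (∀ n x, f n x ∈ Set.Icc (0 : ℝ) 1) ∧
      ∀ P M : Finset ℕ, Disjoint P M →
        ∃ x ∈ T, (∀ n ∈ P, f n x < 1 / 3) ∧ ∀ n ∈ M, 2 / 3 < f n x := by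
  classical
  choose F hFS hF01 hFI using fun S : {S : Finset C(X, ℝ) // IndepOn T S} => S.2.exists_insert hT
  let S : ℕ → {S : Finset C(X, ℝ) // IndepOn T S} :=
    Nat.rec ⟨∅, fun _ => ⟨hne.some, hne.some_mem, by simp⟩⟩ fun _ S => ⟨insert (F S) S.1, hFI S⟩
  have hstep n : (S (n + 1)).1 = insert (F (S n)) (S n).1 := rfl
  have hmono : Monotone fun n => (S n).1 := monotone_nat_of_le_succ fun n => by
    rw [hstep]; exact Finset.subset_insert _ _
  have hmem {m n : ℕ} (h : m < n) : F (S m) ∈ (S n).1 :=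
    hmono (Nat.succ_le_of_lt h) (Finset.mem_insert_self _ _)
  have hinj : Function.Injective fun n => F (S n) := by
    have hne {m n : ℕ} (h : m < n) : F (S m) ≠ F (S n) := fun heq =>
      hFS (S n) (heq ▸ hmem h)
    intro m n heq
    by_contra hmn
    exact (lt_or_gt_of_ne hmn).elim (fun h => hne h heq) fun h => hne h heq.symm
  refine ⟨fun n => F (S n), fun n => hF01 _, fun P M hPM => ?_⟩
  obtain ⟨N, hN⟩ := (P ∪ M).exists_nat_subset_range
  have hN {n} (h : n ∈ P ∪ M) : F (S n) ∈ (S N).1 := hmem (Finset.mem_range.mp (hN h))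
  obtain ⟨x, hxT, hx⟩ := (S N).2 ((fun n => F (S n)) '' P)
  refine ⟨x, hxT, fun n hn => ?_, fun n hn => ?_⟩
  · exact (hx _ (hN (Finset.mem_union_left _ hn))).1 ⟨n, hn, rfl⟩
  · refine (hx _ (hN (Finset.mem_union_right _ hn))).2 ?_
    rintro ⟨m, hm, hmn⟩
    exact Finset.disjoint_left.mp hPM hm (hinj hmn ▸ hn)

theorem TameSpace.isScatteredSpace (h : TameSpace C(X, ℝ)) {L : Set X} (hL : IsCompact L) :
    IsScatteredSpace L := by
  intro T hTne
  by_contra! hT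
  obtain ⟨f, hf01, hf⟩ := exists_indepSeq_of_no_isolated (T := Subtype.val '' T) (hTne.image _) (by
    rintro _ ⟨x, hx, rfl⟩ U hU hUT
    refine hT x hx (Subtype.val ⁻¹' U) (hU.preimage continuous_subtype_val) ?_
    refine Subtype.val_injective.image_injective ?_
    rw [Set.inter_comm, Set.image_inter_preimage, Set.inter_comm, hUT, Set.image_singleton])
  let B : Set C(X, ℝ) := {g | ∀ x, g x ∈ Set.Icc (0 : ℝ) 1}
  let δ : X → WeakDual ℝ C(X, ℝ) := fun x =>
    StrongDual.toWeakDual (ContinuousMap.evalCLM ℝ x)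
  have hδ x (g : C(X, ℝ)) : δ x g = g x := rfl
  have hδc : Continuous δ := WeakDual.continuous_of_continuous_eval fun g => map_continuous g
  have hB : Bornology.IsVonNBounded ℝ B := by
    intro V hV
    obtain ⟨L', -, r, hr, hLV⟩ := ContinuousMap.mem_nhds_zero_iff.mp hV
    refine Absorbs.of_norm ⟨2 / r, fun c hc g hg => ?_⟩
    have hc0 : 0 < |c| := (by positivity : 0 < 2 / r).trans_le hc
    refine (Set.mem_smul_set_iff_inv_smul_mem₀ (abs_pos.mp hc0) _ _).mpr (hLV _ fun x _ => ?_)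
    rw [ContinuousMap.smul_apply, smul_eq_mul, abs_mul, abs_inv, abs_of_nonneg (hg x).1,
      ← div_eq_inv_mul, div_lt_iff₀ hc0]
    rw [Real.norm_eq_abs, div_le_iff₀ hr] at hc
    linarith [(hg x).2]
  have hE : IsEquicontinuousSet (δ '' L) := fun ε hε =>
    ⟨{g | ∀ x ∈ L, |g x| < ε}, ContinuousMap.mem_nhds_zero_iff.mpr ⟨L, hL, ε, hε, fun _ => id⟩, by
      rintro _ ⟨x, hx, rfl⟩ g hg
      exact (hg x hx).le⟩
  refine h B hB (δ '' L) hE (hL.image hδc) ⟨fun n φ => φ.1 (f n),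
    fun n => ⟨f n, hf01 n, rfl⟩, 1 / 3, 2 / 3, by norm_num, fun P M hPM => ?_⟩
  obtain ⟨_, ⟨x, -, rfl⟩, hP, hM⟩ := hf P M hPM
  exact ⟨⟨δ x, x, x.2, rfl⟩, hP, hM⟩

end ContinuousMap

theorem NPSpace.tameSpace {E : Type*} [AddCommGroup E] [Module ℝ E] [TopologicalSpace E]
    (h : NPSpace E) : TameSpace E := by
  intro B hB K hKe hK
  have : CompactSpace K := isCompact_iff_compactSpace.mp hK
  refine (h B hB K hKe hK).isTameFamily ?_
  rintro _ ⟨b, -, rfl⟩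
  exact (WeakDual.eval_continuous b).comp continuous_subtype_val

/-- For a Tychonoff space `X`, the space `C_k(X)` of continuous real
functions with the compact-open topology is tame iff it is Namioka–Phelps iff every
compact subset of `X` is scattered. -/
theorem Ck_tame_iff_NP_iff_scattered
    {X : Type*} [TopologicalSpace X] [CompletelyRegularSpace X] [T2Space X] :
    (TameSpace C(X, ℝ) ↔ NPSpace C(X, ℝ)) ∧
    (TameSpace C(X, ℝ) ↔
      ∀ K : Set X, IsCompact K → IsScatteredSpace K) :=
  ⟨⟨fun h => npSpace_of_isScatteredSpace fun _ => h.isScatteredSpace, NPSpace.tameSpace⟩,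
    fun h _ => h.isScatteredSpace, fun h => (npSpace_of_isScatteredSpace h).tameSpace⟩
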